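/- Let g₀ be the 3-dimensional Lie algebra with basis e₁, e₂, e₃ and nonzero brackets [e₁,e₂] = e₂, [e₁,e₃] = −e₃, and let ω₁, ω₂, ω₃ be the dual basis. Then for the closed form ω₁ and λ = ±1, the cohomology H*_{λω₁}(g₀) is nontrivial with Betti numbers b⁰ = 0, b¹ = 1, b² = 1, b³ = 0; and for a closed form ω with λω ∉ {0, ω₁, −ω₁}, H*_{λω}(g₀) = 0. -/

import Mathlib

set_option linter.unusedSectionVars false

namespace CE

variable (K : Type) [Field K] (L : Type) [LieRing L] [LieAlgebra K L]

/-- A function `(Fin q → L) → K` which is multilinear and alternating: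
the underlying predicate of the space of Lie algebra `q`-cochains `Λ^q(𝔤*)`. -/
def IsCochain {q : ℕ} (F : (Fin q → L) → K) : Prop :=
  (∀ (x : Fin q → L) (i : Fin q) (c : K) (u v : L),
      F (Function.update x i (c • u + v)) =
        c * F (Function.update x i u) + F (Function.update x i v)) ∧
  (∀ (x : Fin q → L) (i j : Fin q), i ≠ j → x i = x j → F x = 0)

/-- The space of `q`-cochains `Λ^q(𝔤*)` as a submodule of all functions. -/
def cochain (q : ℕ) : Submodule K ((Fin q → L) → K) where
  carrier := {F | IsCochain K L F}
  add_mem' := by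
    rintro F G ⟨hF1, hF2⟩ ⟨hG1, hG2⟩
    refine ⟨fun x i c u v => ?_, fun x i j hij hx => ?_⟩
    · simp only [Pi.add_apply, hF1, hG1]; ring
    · simp [Pi.add_apply, hF2 x i j hij hx, hG2 x i j hij hx]
  zero_mem' := ⟨fun x i c u v => by simp, fun x i j h hx => rfl⟩
  smul_mem' := by
    rintro c F ⟨h1, h2⟩
    refine ⟨fun x i a u v => ?_, fun x i j hij hx => ?_⟩
    · simp only [Pi.smul_apply, smul_eq_mul, h1]; ring
    · simp [Pi.smul_apply, h2 x i j hij hx]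

variable {K L}

/-- The part of the Chevalley–Eilenberg differential coming from the
(one-dimensional) representation `ρ`:
`Σᵢ (−1)ⁱ ρ(xᵢ) F(x₀,…,x̂ᵢ,…,x_q)`. -/
def term1 (ρ : L →ₗ[K] K) (q : ℕ) (F : (Fin q → L) → K) (x : Fin (q + 1) → L) : K :=
  ∑ i : Fin (q + 1), (-1 : K) ^ (i : ℕ) * ρ (x i) * F (fun k => x (i.succAbove k))

/-- The part of the Chevalley–Eilenberg differential coming from the Lie bracket;
for alternating multilinear `F` it equals
`Σ_{i<j} (−1)^{i+j} F(⁅xᵢ,xⱼ⁆, x₀, …, x̂ᵢ, …, x̂ⱼ, …, x_q)`, here written by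
putting `⁅xᵢ,xⱼ⁆` in the slot of `xⱼ` after deleting `xᵢ`. -/
def term2 (q : ℕ) (F : (Fin q → L) → K) (x : Fin (q + 1) → L) : K :=
  ∑ i : Fin (q + 1), ∑ j : Fin (q + 1),
    if h : i < j then
      (-1 : K) ^ ((i : ℕ) + 1) *
        F (Function.update (fun k => x (i.succAbove k))
            (j.pred (Fin.ne_zero_of_lt h)) ⁅x i, x j⁆)
    else 0

lemma term1_add (ρ : L →ₗ[K] K) (q : ℕ) (F G : (Fin q → L) → K) (x : Fin (q + 1) → L) :
    term1 ρ q (F + G) x = term1 ρ q F x + term1 ρ q G x := by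
  unfold term1
  rw [← Finset.sum_add_distrib]
  exact Finset.sum_congr rfl fun i _ => by simp [mul_add]

lemma term1_smul (ρ : L →ₗ[K] K) (q : ℕ) (c : K) (F : (Fin q → L) → K)
    (x : Fin (q + 1) → L) : term1 ρ q (c • F) x = c * term1 ρ q F x := by
  unfold term1
  rw [Finset.mul_sum]
  exact Finset.sum_congr rfl fun i _ => by simp; ring

lemma term2_add (q : ℕ) (F G : (Fin q → L) → K) (x : Fin (q + 1) → L) :
    term2 q (F + G) x = term2 q F x + term2 q G x := by
  unfold term2
  rw [← Finset.sum_add_distrib]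
  refine Finset.sum_congr rfl fun i _ => ?_
  rw [← Finset.sum_add_distrib]
  refine Finset.sum_congr rfl fun j _ => ?_
  by_cases h : i < j
  · simp [h, mul_add]
  · simp [h]

lemma term2_smul (q : ℕ) (c : K) (F : (Fin q → L) → K) (x : Fin (q + 1) → L) :
    term2 q (c • F) x = c * term2 q F x := by
  unfold term2
  rw [Finset.mul_sum]
  refine Finset.sum_congr rfl fun i _ => ?_
  rw [Finset.mul_sum]
  refine Finset.sum_congr rfl fun j _ => ?_
  by_cases h : i < j
  · simp [h]; ring
  · simp [h]

variable (K L) in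
/-- The Chevalley–Eilenberg differential of the Lie algebra `L` with coefficients in the
one-dimensional representation `ρ : L →ₗ[K] K`, as a linear map on raw functions.
On the alternating multilinear functions (`cochain`) it is the usual differential
`(d f)(x₀,…,x_q) = Σᵢ (−1)ⁱ ρ(xᵢ) f(…,x̂ᵢ,…) + Σ_{i<j} (−1)^{i+j} f(⁅xᵢ,xⱼ⁆,…,x̂ᵢ,…,x̂ⱼ,…)`. -/
def ceD (ρ : L →ₗ[K] K) (q : ℕ) :
    ((Fin q → L) → K) →ₗ[K] ((Fin (q + 1) → L) → K) where
  toFun F := fun x => term1 ρ q F x + term2 q F x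
  map_add' F G := by
    funext x
    simp only [term1_add, term2_add, Pi.add_apply]
    ring
  map_smul' c F := by
    funext x
    simp only [term1_smul, term2_smul, Pi.smul_apply, smul_eq_mul, RingHom.id_apply]
    ring

variable (K L)

/-- Cocycles: alternating multilinear functions killed by the CE differential. -/
def cocycles (ρ : L →ₗ[K] K) (q : ℕ) : Submodule K ((Fin q → L) → K) :=
  cochain K L q ⊓ LinearMap.ker (ceD K L ρ q)

/-- Coboundaries: images of cochains under the CE differential
(intersected with the cocycles; mathematically the image already consists of cocycles). -/
def coboundaries (ρ : L →ₗ[K] K) : (q : ℕ) → Submodule K ((Fin q → L) → K)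
  | 0 => ⊥
  | (q + 1) =>
      (Submodule.map (ceD K L ρ q) (cochain K L q)) ⊓ cocycles K L ρ (q + 1)

/-- The Chevalley–Eilenberg cohomology `H^q(L, K_ρ)` of `L` with coefficients in the
one-dimensional representation `ρ : L →ₗ[K] K` (for `ρ = 0`: trivial coefficients). -/
def cohomology (ρ : L →ₗ[K] K) (q : ℕ) : Type _ :=
  cocycles K L ρ q ⧸ (coboundaries K L ρ q).comap (cocycles K L ρ q).subtype

instance (ρ : L →ₗ[K] K) (q : ℕ) : AddCommGroup (cohomology K L ρ q) :=
  inferInstanceAs (AddCommGroup (_ ⧸ _))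

instance (ρ : L →ₗ[K] K) (q : ℕ) : Module K (cohomology K L ρ q) :=
  inferInstanceAs (Module K (_ ⧸ _))

end CE

/-- The 3-dimensional completely solvable Lie algebra `g₀` with basis `e₁ = (1,0,0)`,
`e₂ = (0,1,0)`, `e₃ = (0,0,1)` and nonzero brackets `⁅e₁,e₂⁆ = e₂`, `⁅e₁,e₃⁆ = −e₃`. -/
abbrev L3 (K : Type) [Field K] : Type := K × K × K

namespace L3

variable (K : Type) [Field K]

instance : LieRing (L3 K) where
  bracket x y := (0, x.1 * y.2.1 - y.1 * x.2.1, y.1 * x.2.2 - x.1 * y.2.2)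
  add_lie x y z := by
    refine Prod.ext (by simp) (Prod.ext ?_ ?_) <;>
      · show _ = _
        dsimp [Prod.ext_iff]
        ring
  lie_add x y z := by
    refine Prod.ext (by simp) (Prod.ext ?_ ?_) <;>
      · dsimp
        ring
  lie_self x := by
    refine Prod.ext (by simp) (Prod.ext ?_ ?_) <;>
      · dsimp
        ring
  leibniz_lie x y z := by
    refine Prod.ext (by simp) (Prod.ext ?_ ?_) <;>
      · dsimp
        ring

instance : LieAlgebra K (L3 K) where
  lie_smul t x y := by
    refine Prod.ext (show (0 : K) = t * 0 by simp) (Prod.ext ?_ ?_)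
    · show x.1 * (t * y.2.1) - t * y.1 * x.2.1 = t * (x.1 * y.2.1 - y.1 * x.2.1)
      ring
    · show t * y.1 * x.2.2 - x.1 * (t * y.2.2) = t * (y.1 * x.2.2 - x.1 * y.2.2)
      ring

end L3

namespace CE

section Generic

variable {K : Type} [Field K] {L : Type} [LieRing L] [LieAlgebra K L]

/-- A cochain, bundled as an alternating map. -/
def IsCochain.toAlternatingMap {q : ℕ} {F : (Fin q → L) → K} (hF : IsCochain K L F) :
    L [⋀^Fin q]→ₗ[K] K where
  toFun := F
  map_update_add' {inst} x i u v := by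
    obtain rfl : inst = instDecidableEqFin q := Subsingleton.elim _ _
    simpa using hF.1 x i 1 u v
  map_update_smul' {inst} x i c u := by
    obtain rfl : inst = instDecidableEqFin q := Subsingleton.elim _ _
    have h0 : F (Function.update x i 0) = 0 := by simpa using hF.1 x i 1 0 0
    simpa [h0] using hF.1 x i c u 0
  map_eq_zero_of_eq' x i j hx hij := hF.2 x i j hij hx

/-- A cochain vanishes as soon as it vanishes on strictly increasing tuples of basis vectors. -/
lemma IsCochain.eq_zero_of_basis {q n : ℕ} {F : (Fin q → L) → K} (hF : IsCochain K L F)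
    (b : Module.Basis (Fin n) K L)
    (h : ∀ v : Fin q → Fin n, StrictMono v → F (fun k => b (v k)) = 0) : F = 0 := by
  have key : hF.toAlternatingMap = 0 := by
    refine b.ext_alternating fun v hv => ?_
    have hs : StrictMono (v ∘ Tuple.sort v) :=
      (Tuple.monotone_sort v).strictMono_of_injective (hv.comp (Tuple.sort v).injective)
    have h1 := hF.toAlternatingMap.map_perm (fun k => b (v k)) (Tuple.sort v)
    have h2 : hF.toAlternatingMap ((fun k => b (v k)) ∘ Tuple.sort v) = 0 := h _ hs
    rw [h2] at h1
    simpa using (smul_eq_zero_iff_eq _).1 h1.symm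
  exact congrArg (fun G : L [⋀^Fin q]→ₗ[K] K => (G : (Fin q → L) → K)) key

lemma IsCochain.eq_of_basis {q n : ℕ} {F G : (Fin q → L) → K} (hF : IsCochain K L F)
    (hG : IsCochain K L G) (b : Module.Basis (Fin n) K L)
    (h : ∀ v : Fin q → Fin n, StrictMono v → F (fun k => b (v k)) = G (fun k => b (v k))) :
    F = G := by
  have hFG : IsCochain K L (F - G) := (cochain K L q).sub_mem hF hG
  exact sub_eq_zero.1 (hFG.eq_zero_of_basis b fun v hv => by simp [h v hv])

lemma mem_cocycles {ρ : L →ₗ[K] K} {q : ℕ} {F : (Fin q → L) → K} :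
    F ∈ cocycles K L ρ q ↔ IsCochain K L F ∧ ceD K L ρ q F = 0 :=
  Iff.rfl

lemma subsingleton_cohomology {ρ : L →ₗ[K] K} {q : ℕ}
    (h : ∀ F ∈ cocycles K L ρ q, F ∈ coboundaries K L ρ q) :
    Subsingleton (cohomology K L ρ q) :=
  Submodule.Quotient.subsingleton_iff.2 <| by
    rw [eq_top_iff]
    exact fun F _ => h F F.2

lemma finrank_cohomology_eq_one {ρ : L →ₗ[K] K} {q : ℕ} {z : (Fin q → L) → K}
    (hz : z ∈ cocycles K L ρ q) (hz' : z ∉ coboundaries K L ρ q)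
    (h : ∀ F ∈ cocycles K L ρ q, ∃ c : K, c • z - F ∈ coboundaries K L ρ q) :
    Module.finrank K (cohomology K L ρ q) = 1 := by
  let N := (coboundaries K L ρ q).comap (cocycles K L ρ q).subtype
  have key : Module.finrank K (cocycles K L ρ q ⧸ N) = 1 := by
    refine finrank_eq_one (N.mkQ ⟨z, hz⟩) (fun h0 => hz' ?_) fun w => ?_
    · exact (Submodule.Quotient.mk_eq_zero N).1 h0
    · obtain ⟨F, rfl⟩ := N.mkQ_surjective w
      obtain ⟨c, hc⟩ := h F F.2
      refine ⟨c, ?_⟩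
      rw [← map_smul]
      exact (Submodule.Quotient.eq N).2 hc
  exact key

lemma mem_coboundaries_succ {ρ : L →ₗ[K] K} {q : ℕ} {F : (Fin (q + 1) → L) → K}
    {G : (Fin q → L) → K} (hF : F ∈ cocycles K L ρ (q + 1)) (hG : IsCochain K L G)
    (h : ceD K L ρ q G = F) : F ∈ coboundaries K L ρ (q + 1) :=
  ⟨⟨G, hG, h⟩, hF⟩

end Generic

end CE

namespace L3

open CE

variable {K : Type} [Field K]

/-- The basis `e₁, e₂, e₃`. -/
noncomputable def basis : Module.Basis (Fin 3) K (L3 K) :=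
  Module.Basis.ofEquivFun
    { toFun := fun x => ![x.1, x.2.1, x.2.2]
      invFun := fun v => (v 0, v 1, v 2)
      map_add' := fun x y => by ext i; fin_cases i <;> rfl
      map_smul' := fun c x => by ext i; fin_cases i <;> rfl
      left_inv := fun x => rfl
      right_inv := fun v => by ext i; fin_cases i <;> rfl }

lemma basis_apply (i : Fin 3) :
    (basis i : L3 K) =
      ((Pi.single i 1 : Fin 3 → K) 0, (Pi.single i 1 : Fin 3 → K) 1,
        (Pi.single i 1 : Fin 3 → K) 2) := by
  rw [basis, Module.Basis.coe_ofEquivFun]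
  rfl

lemma basis_zero : (basis 0 : L3 K) = (1, 0, 0) := by
  simp [basis_apply]

lemma basis_one : (basis 1 : L3 K) = (0, 1, 0) := by
  simp [basis_apply]

lemma basis_two : (basis 2 : L3 K) = (0, 0, 1) := by
  simp [basis_apply]

lemma lie_def (x y : L3 K) :
    ⁅x, y⁆ = (0, x.1 * y.2.1 - y.1 * x.2.1, y.1 * x.2.2 - x.1 * y.2.2) := rfl

/-- The `1`-form `p ω₁ + q ω₂ + r ω₃`. -/
def form₁ (p q r : K) (x : Fin 1 → L3 K) : K :=
  p * (x 0).1 + q * (x 0).2.1 + r * (x 0).2.2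

/-- The `2`-form `u ω₁ ∧ ω₂ + v ω₁ ∧ ω₃ + w ω₂ ∧ ω₃`. -/
def form₂ (u v w : K) (x : Fin 2 → L3 K) : K :=
  u * ((x 0).1 * (x 1).2.1 - (x 1).1 * (x 0).2.1) +
  v * ((x 0).1 * (x 1).2.2 - (x 1).1 * (x 0).2.2) +
  w * ((x 0).2.1 * (x 1).2.2 - (x 1).2.1 * (x 0).2.2)

/-- The `3`-form `t ω₁ ∧ ω₂ ∧ ω₃`. -/
def form₃ (t : K) (x : Fin 3 → L3 K) : K :=
  t * ((x 0).1 * ((x 1).2.1 * (x 2).2.2 - (x 2).2.1 * (x 1).2.2) -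
    (x 1).1 * ((x 0).2.1 * (x 2).2.2 - (x 2).2.1 * (x 0).2.2) +
    (x 2).1 * ((x 0).2.1 * (x 1).2.2 - (x 1).2.1 * (x 0).2.2))

lemma isCochain_const (c : K) : IsCochain K (L3 K) (fun _ : Fin 0 → L3 K => c) :=
  ⟨fun _ i => i.elim0, fun _ i => i.elim0⟩

lemma isCochain_form₁ (p q r : K) : IsCochain K (L3 K) (form₁ p q r) := by
  refine ⟨fun x i c u v => ?_, fun x i j hij => (hij (Subsingleton.elim i j)).elim⟩
  fin_cases i
  simp [form₁]
  ring

lemma isCochain_form₂ (u v w : K) : IsCochain K (L3 K) (form₂ u v w) := by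
  refine ⟨fun x i c y z => ?_, fun x i j hij hx => ?_⟩
  · fin_cases i <;> simp [form₂] <;> ring
  · fin_cases i <;> fin_cases j <;> simp at hij hx <;> simp [form₂, hx]

lemma isCochain_form₃ (t : K) : IsCochain K (L3 K) (form₃ t) := by
  refine ⟨fun x i c y z => ?_, fun x i j hij hx => ?_⟩
  · fin_cases i <;> simp [form₃] <;> ring
  · fin_cases i <;> fin_cases j <;> simp at hij hx <;> simp only [form₃, hx] <;> ring

lemma exists_eq_const (F : (Fin 0 → L3 K) → K) : ∃ c, F = fun _ => c :=
  ⟨F ![], funext fun x => by rw [Subsingleton.elim x ![]]⟩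

lemma exists_eq_form₁ {F : (Fin 1 → L3 K) → K} (hF : IsCochain K (L3 K) F) :
    ∃ p q r, F = form₁ p q r := by
  refine ⟨F fun _ => basis 0, F fun _ => basis 1, F fun _ => basis 2,
    hF.eq_of_basis (isCochain_form₁ _ _ _) basis fun v _ => ?_⟩
  have hv : (fun k => basis (v k) : Fin 1 → L3 K) = fun _ => basis (v 0) :=
    funext fun k => by rw [Subsingleton.elim k 0]
  rw [hv]
  generalize v 0 = a
  fin_cases a <;> simp [form₁, basis_zero, basis_one, basis_two]

lemma exists_eq_form₂ {F : (Fin 2 → L3 K) → K} (hF : IsCochain K (L3 K) F) :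
    ∃ u v w, F = form₂ u v w := by
  refine ⟨F ![basis 0, basis 1], F ![basis 0, basis 2], F ![basis 1, basis 2],
    hF.eq_of_basis (isCochain_form₂ _ _ _) basis fun v hv => ?_⟩
  have h01 : v 0 < v 1 := hv (by decide)
  have hv : (fun k => basis (v k) : Fin 2 → L3 K) = ![basis (v 0), basis (v 1)] := by
    ext1 k; fin_cases k <;> rfl
  rw [hv]
  generalize v 0 = a at *
  generalize v 1 = b at *
  fin_cases a <;> fin_cases b <;> simp at h01 <;>
    simp [form₂, basis_zero, basis_one, basis_two]

lemma exists_eq_form₃ {F : (Fin 3 → L3 K) → K} (hF : IsCochain K (L3 K) F) :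
    ∃ t, F = form₃ t := by
  refine ⟨F basis, hF.eq_of_basis (isCochain_form₃ _) basis fun v hv => ?_⟩
  obtain rfl : v = id := by
    have h01 : v 0 < v 1 := hv (by decide)
    have h12 : v 1 < v 2 := hv (by decide)
    ext k
    fin_cases k <;> simp <;> omega
  simp [form₃, basis_zero, basis_one, basis_two]

lemma eq_zero_of_isCochain {q : ℕ} (hq : 3 < q) {F : (Fin q → L3 K) → K}
    (hF : IsCochain K (L3 K) F) : F = 0 :=
  hF.eq_zero_of_basis basis fun v hv => by
    have := Fintype.card_le_of_injective v hv.injective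
    simp at this
    omega

lemma ceD_const (a c : K) :
    ceD K (L3 K) (a • LinearMap.fst K K (K × K)) 0 (fun _ => c) = form₁ (a * c) 0 0 := by
  ext x
  simp [ceD, term1, term2, form₁]
  ring

lemma ceD_form₁ (a p q r : K) :
    ceD K (L3 K) (a • LinearMap.fst K K (K × K)) 1 (form₁ p q r) =
      form₂ ((a - 1) * q) ((a + 1) * r) 0 := by
  ext x
  simp [ceD, term1, term2, form₁, form₂, Fin.sum_univ_succ, lie_def, Fin.succAbove]
  ring

lemma ceD_form₂ (a u v w : K) :
    ceD K (L3 K) (a • LinearMap.fst K K (K × K)) 2 (form₂ u v w) = form₃ (a * w) := by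
  ext x
  simp [ceD, term1, term2, form₂, form₃, Fin.sum_univ_succ, lie_def, Fin.succAbove]
  ring

lemma form₁_inj {p q r p' q' r' : K} :
    form₁ p q r = form₁ p' q' r' ↔ p = p' ∧ q = q' ∧ r = r' := by
  refine ⟨fun h => ⟨?_, ?_, ?_⟩, by rintro ⟨rfl, rfl, rfl⟩; rfl⟩
  · simpa [form₁] using congrFun h ![(1, 0, 0)]
  · simpa [form₁] using congrFun h ![(0, 1, 0)]
  · simpa [form₁] using congrFun h ![(0, 0, 1)]

lemma form₂_inj {u v w u' v' w' : K} :
    form₂ u v w = form₂ u' v' w' ↔ u = u' ∧ v = v' ∧ w = w' := by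
  refine ⟨fun h => ⟨?_, ?_, ?_⟩, by rintro ⟨rfl, rfl, rfl⟩; rfl⟩
  · simpa [form₂] using congrFun h ![(1, 0, 0), (0, 1, 0)]
  · simpa [form₂] using congrFun h ![(1, 0, 0), (0, 0, 1)]
  · simpa [form₂] using congrFun h ![(0, 1, 0), (0, 0, 1)]

lemma form₃_inj {t t' : K} : form₃ t = form₃ t' ↔ t = t' := by
  refine ⟨fun h => ?_, by rintro rfl; rfl⟩
  simpa [form₃] using congrFun h ![(1, 0, 0), (0, 1, 0), (0, 0, 1)]

lemma form₁_mem_cocycles {a p q r : K} :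
    form₁ p q r ∈ cocycles K (L3 K) (a • LinearMap.fst K K (K × K)) 1 ↔
      (a - 1) * q = 0 ∧ (a + 1) * r = 0 := by
  have h0 : (0 : (Fin 2 → L3 K) → K) = form₂ 0 0 0 := by ext; simp [form₂]
  rw [mem_cocycles, ceD_form₁, h0, form₂_inj]
  simp [isCochain_form₁]

lemma form₂_mem_cocycles {a u v w : K} :
    form₂ u v w ∈ cocycles K (L3 K) (a • LinearMap.fst K K (K × K)) 2 ↔ a * w = 0 := by
  have h0 : (0 : (Fin 3 → L3 K) → K) = form₃ 0 := by ext; simp [form₃]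
  rw [mem_cocycles, ceD_form₂, h0, form₃_inj]
  simp [isCochain_form₂]

lemma form₁_mem_coboundaries {a p q r : K} (ha : a ≠ 0) :
    form₁ p q r ∈ coboundaries K (L3 K) (a • LinearMap.fst K K (K × K)) 1 ↔
      q = 0 ∧ r = 0 := by
  constructor
  · rintro ⟨⟨G, -, hG⟩, -⟩
    obtain ⟨c, rfl⟩ := exists_eq_const G
    rw [ceD_const, form₁_inj] at hG
    exact ⟨hG.2.1.symm, hG.2.2.symm⟩
  · rintro ⟨rfl, rfl⟩
    refine mem_coboundaries_succ (form₁_mem_cocycles.2 (by simp)) (isCochain_const (a⁻¹ * p)) ?_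
    rw [ceD_const, mul_inv_cancel_left₀ ha]

lemma form₂_mem_coboundaries {a u v w : K} :
    form₂ u v w ∈ coboundaries K (L3 K) (a • LinearMap.fst K K (K × K)) 2 ↔
      (∃ q, (a - 1) * q = u) ∧ (∃ r, (a + 1) * r = v) ∧ w = 0 := by
  constructor
  · rintro ⟨⟨G, hG', hG⟩, -⟩
    obtain ⟨p, q, r, rfl⟩ := exists_eq_form₁ hG'
    rw [ceD_form₁, form₂_inj] at hG
    exact ⟨⟨q, hG.1⟩, ⟨r, hG.2.1⟩, hG.2.2.symm⟩
  · rintro ⟨⟨q, rfl⟩, ⟨r, rfl⟩, rfl⟩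
    exact mem_coboundaries_succ (form₂_mem_cocycles.2 (by simp)) (isCochain_form₁ 0 q r)
      (ceD_form₁ a 0 q r)

lemma subsingleton_cohomology_zero {a : K} (ha : a ≠ 0) :
    Subsingleton (cohomology K (L3 K) (a • LinearMap.fst K K (K × K)) 0) := by
  refine subsingleton_cohomology fun F hF => ?_
  obtain ⟨c, rfl⟩ := exists_eq_const F
  have h0 : (0 : (Fin 1 → L3 K) → K) = form₁ 0 0 0 := by ext; simp [form₁]
  have h := (mem_cocycles.1 hF).2
  rw [ceD_const, h0, form₁_inj] at h
  obtain rfl : c = 0 := (mul_eq_zero.1 h.1).resolve_left ha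
  exact (coboundaries K (L3 K) _ 0).zero_mem

lemma subsingleton_cohomology_three {a : K} (ha : a ≠ 0) :
    Subsingleton (cohomology K (L3 K) (a • LinearMap.fst K K (K × K)) 3) := by
  refine subsingleton_cohomology fun F hF => ?_
  obtain ⟨t, rfl⟩ := exists_eq_form₃ hF.1
  refine mem_coboundaries_succ hF (isCochain_form₂ 0 0 (a⁻¹ * t)) ?_
  rw [ceD_form₂, mul_inv_cancel_left₀ ha]

lemma subsingleton_cohomology_of_ne {a : K} (ha : a ≠ 0) (h1 : a ≠ 1) (h2 : a ≠ -1) (q : ℕ) :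
    Subsingleton (cohomology K (L3 K) (a • LinearMap.fst K K (K × K)) q) := by
  have h1' : a - 1 ≠ 0 := sub_ne_zero.2 h1
  have h2' : a + 1 ≠ 0 := fun h => h2 (eq_neg_of_add_eq_zero_left h)
  match q with
  | 0 => exact subsingleton_cohomology_zero ha
  | 1 =>
    refine subsingleton_cohomology fun F hF => ?_
    obtain ⟨p, q, r, rfl⟩ := exists_eq_form₁ hF.1
    rw [form₁_mem_cocycles] at hF
    rw [form₁_mem_coboundaries ha]
    simpa [h1', h2'] using hF
  | 2 =>
    refine subsingleton_cohomology fun F hF => ?_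
    obtain ⟨u, v, w, rfl⟩ := exists_eq_form₂ hF.1
    rw [form₂_mem_cocycles] at hF
    exact form₂_mem_coboundaries.2 ⟨⟨_, mul_inv_cancel_left₀ h1' u⟩,
      ⟨_, mul_inv_cancel_left₀ h2' v⟩, (mul_eq_zero.1 hF).resolve_left ha⟩
  | 3 => exact subsingleton_cohomology_three ha
  | n + 4 =>
    refine subsingleton_cohomology fun F hF => ?_
    rw [eq_zero_of_isCochain (by omega) hF.1]
    exact Submodule.zero_mem _

lemma smul_form₁_sub (c p q r p' q' r' : K) :
    c • form₁ p q r - form₁ p' q' r' = form₁ (c * p - p') (c * q - q') (c * r - r') := by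
  ext x
  simp [form₁]
  ring

lemma smul_form₂_sub (c u v w u' v' w' : K) :
    c • form₂ u v w - form₂ u' v' w' = form₂ (c * u - u') (c * v - v') (c * w - w') := by
  ext x
  simp [form₂]
  ring

lemma finrank_cohomology_one [CharZero K] {a : K} (ha : a = 1 ∨ a = -1) :
    Module.finrank K (cohomology K (L3 K) (a • LinearMap.fst K K (K × K)) 1) = 1 := by
  have ha0 : a ≠ 0 := by rintro rfl; simp at ha
  have hz : form₁ 0 (a + 1) (a - 1) ∈
      cocycles K (L3 K) (a • LinearMap.fst K K (K × K)) 1 := by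
    rw [form₁_mem_cocycles]
    rcases ha with rfl | rfl <;> simp
  refine finrank_cohomology_eq_one hz ?_ fun F hF => ?_
  · rw [form₁_mem_coboundaries ha0]
    rcases ha with rfl | rfl <;> norm_num
  · obtain ⟨p, q, r, rfl⟩ := exists_eq_form₁ hF.1
    rw [form₁_mem_cocycles] at hF
    simp only [smul_form₁_sub, form₁_mem_coboundaries ha0]
    rcases ha with rfl | rfl
    · have hr : r = 0 := by linear_combination hF.2 / 2
      exact ⟨q / 2, by ring, by simp [hr]⟩
    · have hq : q = 0 := by linear_combination -hF.1 / 2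
      exact ⟨-r / 2, by simp [hq], by ring⟩

lemma finrank_cohomology_two [CharZero K] {a : K} (ha : a = 1 ∨ a = -1) :
    Module.finrank K (cohomology K (L3 K) (a • LinearMap.fst K K (K × K)) 2) = 1 := by
  have ha0 : a ≠ 0 := by rintro rfl; simp at ha
  have hz : form₂ (a + 1) (a - 1) 0 ∈
      cocycles K (L3 K) (a • LinearMap.fst K K (K × K)) 2 := by
    rw [form₂_mem_cocycles, mul_zero]
  refine finrank_cohomology_eq_one hz ?_ fun F hF => ?_
  · rw [form₂_mem_coboundaries]
    rcases ha with rfl | rfl <;> norm_num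
  · obtain ⟨u, v, w, rfl⟩ := exists_eq_form₂ hF.1
    rw [form₂_mem_cocycles] at hF
    obtain rfl : w = 0 := (mul_eq_zero.1 hF).resolve_left ha0
    simp only [smul_form₂_sub, form₂_mem_coboundaries]
    rcases ha with rfl | rfl
    · exact ⟨u / 2, ⟨0, by ring⟩, ⟨-v / 2, by ring⟩, by ring⟩
    · exact ⟨-v / 2, ⟨u / 2, by ring⟩, ⟨0, by ring⟩, by ring⟩

lemma eq_smul_fst_of_closed {ω : L3 K →ₗ[K] K} (hω : ∀ x y : L3 K, ω ⁅x, y⁆ = 0) :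
    ω = ω (1, 0, 0) • LinearMap.fst K K (K × K) := by
  have h2 : ω (0, 1, 0) = 0 := by simpa [lie_def] using hω (1, 0, 0) (0, 1, 0)
  have h3 : ω (0, 0, 1) = 0 := by simpa [lie_def] using hω (0, 0, 1) (1, 0, 0)
  refine basis.ext fun i => ?_
  fin_cases i <;> simp [basis_zero, basis_one, basis_two, h2, h3]

end L3

/-- Let `g₀` be the 3-dimensional Lie algebra with basis `e₁,e₂,e₃`,
nonzero brackets `⁅e₁,e₂⁆ = e₂`, `⁅e₁,e₃⁆ = −e₃`, and dual basis `ω₁,ω₂,ω₃`. For the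
closed form `ω₁` and `λ = ±1`, the cohomology `H*_{λω₁}(g₀)` is nontrivial, with Betti
numbers `b⁰ = 0`, `b¹ = 1`, `b² = 1`, `b³ = 0`; and for a closed form `ω` with
`λω ∉ {0, ω₁, −ω₁}`, `H*_{λω}(g₀) = 0` in all degrees. -/
theorem stmt17 (K : Type) [Field K] [CharZero K] :
    (∀ l : K, l = 1 ∨ l = -1 →
      Module.finrank K (CE.cohomology K (L3 K) (l • LinearMap.fst K K (K × K)) 0) = 0 ∧
      Module.finrank K (CE.cohomology K (L3 K) (l • LinearMap.fst K K (K × K)) 1) = 1 ∧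
      Module.finrank K (CE.cohomology K (L3 K) (l • LinearMap.fst K K (K × K)) 2) = 1 ∧
      Module.finrank K (CE.cohomology K (L3 K) (l • LinearMap.fst K K (K × K)) 3) = 0) ∧
    ∀ (ω : L3 K →ₗ[K] K) (l : K), (∀ x y : L3 K, ω ⁅x, y⁆ = 0) →
      l • ω ≠ 0 → l • ω ≠ LinearMap.fst K K (K × K) →
      l • ω ≠ -LinearMap.fst K K (K × K) →
      ∀ q : ℕ, Subsingleton (CE.cohomology K (L3 K) (l • ω) q) := by
  refine ⟨fun l hl => ?_, fun ω l hω h0 h1 h2 q => ?_⟩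
  · have hl0 : l ≠ 0 := by rintro rfl; simp at hl
    have := L3.subsingleton_cohomology_zero hl0
    have := L3.subsingleton_cohomology_three hl0
    exact ⟨Module.finrank_zero_of_subsingleton, L3.finrank_cohomology_one hl,
      L3.finrank_cohomology_two hl, Module.finrank_zero_of_subsingleton⟩
  · rw [L3.eq_smul_fst_of_closed hω, smul_smul] at h0 h1 h2 ⊢
    refine L3.subsingleton_cohomology_of_ne ?_ ?_ ?_ q
    · exact fun h => h0 (by rw [h, zero_smul])
    · exact fun h => h1 (by rw [h, one_smul])
    · exact fun h => h2 (by rw [h, neg_one_smul])
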